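/- arXiv:math/0210326 — 6 statements merged into one kernel-verified Lean document; each statement's English description precedes it below -/
import Mathlib

section
/- Let h₀, h₁, h₂ ∈ ℝ³ be nonzero vectors in the open positive light cone (⟨hᵢ,hᵢ⟩ = 0 and the third coordinate of each hᵢ is positive) which are pairwise not scalar multiples of one another. Then h₀, h₁, h₂ are linearly independent in ℝ³. -/
/-- The Minkowski bilinear form on ℝ³: ⟨x,y⟩ = x₀y₀ + x₁y₁ − x₂y₂. -/
def mink (x y : Fin 3 → ℝ) : ℝ := x 0 * y 0 + x 1 * y 1 - x 2 * y 2

/-- Orthogonal null vectors are proportional: if `x 2 ≠ 0`, then `y` is a multiple of `x`. -/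
theorem exists_eq_smul_of_mink_eq_zero {x y : Fin 3 → ℝ} (hx : mink x x = 0) (hx2 : x 2 ≠ 0)
    (hy : mink y y = 0) (hxy : mink x y = 0) : ∃ c : ℝ, y = c • x := by
  unfold mink at hx hy hxy
  have key : (x 2 * y 0 - y 2 * x 0) ^ 2 + (x 2 * y 1 - y 2 * x 1) ^ 2 = 0 := by
    linear_combination (x 2) ^ 2 * hy + (y 2) ^ 2 * hx - 2 * x 2 * y 2 * hxy
  have e0 : x 2 * y 0 - y 2 * x 0 = 0 := by
    nlinarith [sq_nonneg (x 2 * y 0 - y 2 * x 0), sq_nonneg (x 2 * y 1 - y 2 * x 1)]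
  have e1 : x 2 * y 1 - y 2 * x 1 = 0 := by
    nlinarith [sq_nonneg (x 2 * y 0 - y 2 * x 0), sq_nonneg (x 2 * y 1 - y 2 * x 1)]
  refine ⟨y 2 / x 2, ?_⟩
  ext i
  fin_cases i <;> simp <;> field_simp <;> linarith

/-- Three null vectors with pairwise nonzero Minkowski products are linearly independent. -/
theorem linearIndependent_of_mink_ne_zero {x y z : Fin 3 → ℝ}
    (hx : mink x x = 0) (hy : mink y y = 0) (hz : mink z z = 0)
    (hxy : mink x y ≠ 0) (hxz : mink x z ≠ 0) (hyz : mink y z ≠ 0) :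
    LinearIndependent ℝ ![x, y, z] := by
  rw [Fintype.linearIndependent_iff]
  intro g hg
  have coord (i : Fin 3) : g 0 * x i + g 1 * y i + g 2 * z i = 0 := by
    simpa [Fin.sum_univ_three] using congrFun hg i
  have pairing (w : Fin 3 → ℝ) : g 0 * mink x w + g 1 * mink y w + g 2 * mink z w = 0 := by
    unfold mink
    linear_combination w 0 * coord 0 + w 1 * coord 1 - w 2 * coord 2
  have comm (u v : Fin 3 → ℝ) : mink u v = mink v u := by
    unfold mink
    ring
  have px := pairing x
  have py := pairing y
  have pz := pairing z
  rw [hx, comm y x, comm z x] at px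
  rw [hy, comm z y] at py
  rw [hz] at pz
  have a0 : g 0 = 0 := by
    have : g 0 * (mink x y * mink x z) = 0 := by
      linear_combination (mink x z * py + mink x y * pz - mink y z * px) / 2
    exact (mul_eq_zero.mp this).resolve_right (mul_ne_zero hxy hxz)
  have a1 : g 1 = 0 := by simpa [a0, hyz] using pz
  have a2 : g 2 = 0 := by simpa [a0, hyz] using py
  intro i
  fin_cases i <;> assumption

/-- Three points of the open positive light cone that are pairwise not scalar
multiples of one another are linearly independent in ℝ³. -/
theorem lightcone_triple_linearIndependent
    (h₀ h₁ h₂ : Fin 3 → ℝ)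
    (h₀0 : h₀ ≠ 0) (h₀₀ : mink h₀ h₀ = 0) (h₀2 : 0 < h₀ 2)
    (h₁0 : h₁ ≠ 0) (h₁₁ : mink h₁ h₁ = 0) (h₁2 : 0 < h₁ 2)
    (h₂0 : h₂ ≠ 0) (h₂₂ : mink h₂ h₂ = 0) (h₂2 : 0 < h₂ 2)
    (h01 : ¬ ∃ c : ℝ, h₁ = c • h₀)
    (h02 : ¬ ∃ c : ℝ, h₂ = c • h₀)
    (h12 : ¬ ∃ c : ℝ, h₂ = c • h₁) :
    LinearIndependent ℝ ![h₀, h₁, h₂] := by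
  exact linearIndependent_of_mink_ne_zero h₀₀ h₁₁ h₂₂
    (fun h => h01 (exists_eq_smul_of_mink_eq_zero h₀₀ h₀2.ne' h₁₁ h))
    (fun h => h02 (exists_eq_smul_of_mink_eq_zero h₀₀ h₀2.ne' h₂₂ h))
    (fun h => h12 (exists_eq_smul_of_mink_eq_zero h₁₁ h₁2.ne' h₂₂ h))
end

section
/- Let h₀, h₁, h₂ ∈ ℝ³ be nonzero vectors in the open positive light cone which are pairwise not scalar multiples of one another, and for {j,k,ℓ} = {0,1,2} set λⱼ = √(−⟨h_k,h_ℓ⟩). Then there exists a point x on the upper hyperboloid (⟨x,x⟩ = −1, x₂ > 0) with ⟨x,h₀⟩ = ⟨x,h₁⟩ = ⟨x,h₂⟩ (i.e., a point equidistant from the three horocycles determined by h₀, h₁, h₂) if and only if λ₀, λ₁, λ₂ satisfy all three strict triangle inequalities λ₀ < λ₁+λ₂, λ₁ < λ₀+λ₂, λ₂ < λ₀+λ₁. -/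
/-- Two nonproportional vectors of the open positive light cone have negative Minkowski product. -/
theorem mink_neg_of_null {u v : Fin 3 → ℝ} (huu : mink u u = 0) (hu : 0 < u 2)
    (hvv : mink v v = 0) (hv : 0 < v 2) (huv : ¬ ∃ c : ℝ, v = c • u) : mink u v < 0 := by
  by_contra! h
  apply huv
  obtain ⟨c, hc⟩ : ∃ c, c = v 2 / u 2 := ⟨_, rfl⟩
  have hc0 : 0 < c := hc ▸ div_pos hv hu
  have h2 : v 2 = c * u 2 := by rw [hc]; field_simp
  have key : (v 0 - c * u 0) ^ 2 + (v 1 - c * u 1) ^ 2 = -(2 * c * mink u v) := by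
    unfold mink at *
    rw [h2] at hvv ⊢
    linear_combination hvv + c ^ 2 * huu
  have hle : (v 0 - c * u 0) ^ 2 + (v 1 - c * u 1) ^ 2 ≤ 0 := by
    rw [key]
    have : 0 ≤ 2 * c * mink u v := by positivity
    linarith
  have e0 : v 0 - c * u 0 = 0 := by
    rw [← sq_eq_zero_iff]; nlinarith [sq_nonneg (v 0 - c * u 0), sq_nonneg (v 1 - c * u 1)]
  have e1 : v 1 - c * u 1 = 0 := by
    rw [← sq_eq_zero_iff]; nlinarith [sq_nonneg (v 0 - c * u 0), sq_nonneg (v 1 - c * u 1)]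
  refine ⟨c, ?_⟩
  ext i
  fin_cases i
  · simpa using sub_eq_zero.mp e0
  · simpa using sub_eq_zero.mp e1
  · simpa using h2

/-- Any four vectors of a three-dimensional space have vanishing Gram determinant. -/
theorem mink_gram_det (x u v w : Fin 3 → ℝ) :
    !![mink x x, mink x u, mink x v, mink x w;
       mink x u, mink u u, mink u v, mink u w;
       mink x v, mink u v, mink v v, mink v w;
       mink x w, mink u w, mink v w, mink w w].det = 0 := by
  have h : !![mink x x, mink x u, mink x v, mink x w;
       mink x u, mink u u, mink u v, mink u w;
       mink x v, mink u v, mink v v, mink v w;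
       mink x w, mink u w, mink v w, mink w w] =
      !![x 0, x 1, -x 2, 0; u 0, u 1, -u 2, 0; v 0, v 1, -v 2, 0; w 0, w 1, -w 2, 0] *
      !![x 0, u 0, v 0, w 0; x 1, u 1, v 1, w 1; x 2, u 2, v 2, w 2; 0, 0, 0, 0] := by
    ext i j
    fin_cases i <;> fin_cases j <;>
      simp [Matrix.mul_apply, Fin.sum_univ_four, mink] <;> ring
  rw [h, Matrix.det_mul, Matrix.det_eq_zero_of_row_eq_zero
    (A := !![x 0, u 0, v 0, w 0; x 1, u 1, v 1, w 1; x 2, u 2, v 2, w 2; 0, 0, 0, 0]) 3, mul_zero]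
  intro j
  fin_cases j <;> rfl

/-- Heron's criterion: positive reals are the sides of a nondegenerate triangle iff the
Heron polynomial in their squares is positive. -/
theorem heron_pos_iff_triangle {p q r : ℝ} (hp : 0 < p) (hq : 0 < q) (hr : 0 < r) :
    0 < 2 * (p ^ 2 * q ^ 2 + q ^ 2 * r ^ 2 + r ^ 2 * p ^ 2) -
        ((p ^ 2) ^ 2 + (q ^ 2) ^ 2 + (r ^ 2) ^ 2) ↔
      (p < q + r ∧ q < p + r ∧ r < p + q) := by
  have hf : 2 * (p ^ 2 * q ^ 2 + q ^ 2 * r ^ 2 + r ^ 2 * p ^ 2) -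
      ((p ^ 2) ^ 2 + (q ^ 2) ^ 2 + (r ^ 2) ^ 2) =
      (p + q + r) * ((q + r - p) * ((p + r - q) * (p + q - r))) := by ring
  rw [hf, mul_pos_iff_of_pos_left (by positivity)]
  constructor
  · intro h
    refine ⟨?_, ?_, ?_⟩ <;> by_contra! hle
    · nlinarith [mul_pos (show 0 < p + r - q by linarith) (show 0 < p + q - r by linarith)]
    · nlinarith [mul_pos (show 0 < q + r - p by linarith) (show 0 < p + q - r by linarith)]
    · nlinarith [mul_pos (show 0 < q + r - p by linarith) (show 0 < p + r - q by linarith)]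
  · rintro ⟨h1, h2, h3⟩
    exact mul_pos (by linarith) (mul_pos (by linarith) (by linarith))

/-- Three null vectors with negative pairwise Minkowski products have an equidistant point iff the
Heron polynomial of these products is positive. -/
theorem exists_equidistant_iff_heron_pos {u v w : Fin 3 → ℝ} (huu : mink u u = 0)
    (hvv : mink v v = 0) (hww : mink w w = 0) {a b c : ℝ} (ha : 0 < a) (hb : 0 < b) (hc : 0 < c)
    (hvw : mink v w = -a) (huw : mink u w = -b) (huv : mink u v = -c) :
    (∃ x : Fin 3 → ℝ, mink x x = -1 ∧ 0 < x 2 ∧ mink x u = mink x v ∧ mink x v = mink x w) ↔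
      0 < 2 * (a * b + b * c + c * a) - (a ^ 2 + b ^ 2 + c ^ 2) := by
  constructor
  · rintro ⟨x, hx, -, h1, h2⟩
    have hG := mink_gram_det x u v w
    rw [huu, hvv, hww, hvw, huw, huv, hx, h1, h2] at hG
    simp [Matrix.det_succ_row_zero, Fin.sum_univ_succ, Fin.succAbove] at hG
    have key : mink x w ^ 2 * (2 * (a * b + b * c + c * a) - (a ^ 2 + b ^ 2 + c ^ 2)) =
        2 * (a * b * c) := by
      linear_combination -hG
    have : 0 < 2 * (a * b * c) := by positivity
    exact pos_of_mul_pos_right (key ▸ this) (sq_nonneg _)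
  · intro hD
    obtain ⟨D, hDdef⟩ : ∃ D, D = 2 * (a * b + b * c + c * a) - (a ^ 2 + b ^ 2 + c ^ 2) := ⟨_, rfl⟩
    rw [← hDdef] at hD
    obtain ⟨y, hy⟩ : ∃ y : Fin 3 → ℝ, y =
        (a * (b + c - a)) • u + (b * (a + c - b)) • v + (c * (a + b - c)) • w := ⟨_, rfl⟩
    have lin (z : Fin 3 → ℝ) : mink y z = a * (b + c - a) * mink u z +
        b * (a + c - b) * mink v z + c * (a + b - c) * mink w z := by
      simp only [hy, mink, Pi.add_apply, Pi.smul_apply, smul_eq_mul]; ring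
    have comm (s z : Fin 3 → ℝ) : mink s z = mink z s := by unfold mink; ring
    have smul (k : ℝ) (s z : Fin 3 → ℝ) : mink (k • s) z = k * mink s z := by
      simp only [mink, Pi.smul_apply, smul_eq_mul]; ring
    have yu : mink y u = -(2 * a * b * c) := by
      rw [lin, huu, comm v u, comm w u, huv, huw]; ring
    have yv : mink y v = -(2 * a * b * c) := by
      rw [lin, hvv, comm w v, huv, hvw]; ring
    have yw : mink y w = -(2 * a * b * c) := by
      rw [lin, hww, huw, hvw]; ring
    have yy : mink y y = -(2 * a * b * c * D) := by
      rw [lin, comm u, comm v, comm w, yu, yv, yw, hDdef]; ring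
    have hN : 0 < 2 * a * b * c * D := by positivity
    have hy2 : y 2 ≠ 0 := by
      intro h0
      have : mink y y = y 0 ^ 2 + y 1 ^ 2 := by unfold mink; rw [h0]; ring
      nlinarith [sq_nonneg (y 0), sq_nonneg (y 1)]
    obtain ⟨k, hk, hk2⟩ : ∃ k : ℝ, k ^ 2 * (2 * a * b * c * D) = 1 ∧ 0 < k * y 2 := by
      have hs := Real.sqrt_pos.mpr hN
      have hq := Real.sq_sqrt hN.le
      rcases hy2.lt_or_gt with h | h
      · refine ⟨-(√(2 * a * b * c * D))⁻¹, ?_, ?_⟩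
        · rw [neg_sq, inv_pow, hq, inv_mul_cancel₀ hN.ne']
        · exact mul_pos_of_neg_of_neg (neg_neg_of_pos (inv_pos.mpr hs)) h
      · refine ⟨(√(2 * a * b * c * D))⁻¹, ?_, mul_pos (inv_pos.mpr hs) h⟩
        rw [inv_pow, hq, inv_mul_cancel₀ hN.ne']
    refine ⟨k • y, ?_, by simpa using hk2, ?_, ?_⟩
    · rw [smul, comm, smul, yy]; linear_combination -hk
    · rw [smul, smul, yu, yv]
    · rw [smul, smul, yv, yw]

/-- There is a point of the upper hyperboloid equidistant from the three
horocycles determined by `h₀, h₁, h₂` in the open positive light cone iff the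
pairwise lambda lengths satisfy all three strict triangle inequalities. -/
theorem equidistant_point_exists_iff_triangle
    (h₀ h₁ h₂ : Fin 3 → ℝ)
    (h₀0 : h₀ ≠ 0) (h₀₀ : mink h₀ h₀ = 0) (h₀2 : 0 < h₀ 2)
    (h₁0 : h₁ ≠ 0) (h₁₁ : mink h₁ h₁ = 0) (h₁2 : 0 < h₁ 2)
    (h₂0 : h₂ ≠ 0) (h₂₂ : mink h₂ h₂ = 0) (h₂2 : 0 < h₂ 2)
    (h01 : ¬ ∃ c : ℝ, h₁ = c • h₀)
    (h02 : ¬ ∃ c : ℝ, h₂ = c • h₀)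
    (h12 : ¬ ∃ c : ℝ, h₂ = c • h₁)
    (l₀ l₁ l₂ : ℝ)
    (hl₀ : l₀ = Real.sqrt (-(mink h₁ h₂)))
    (hl₁ : l₁ = Real.sqrt (-(mink h₀ h₂)))
    (hl₂ : l₂ = Real.sqrt (-(mink h₀ h₁))) :
    (∃ x : Fin 3 → ℝ, mink x x = -1 ∧ 0 < x 2 ∧
        mink x h₀ = mink x h₁ ∧ mink x h₁ = mink x h₂) ↔
      (l₀ < l₁ + l₂ ∧ l₁ < l₀ + l₂ ∧ l₂ < l₀ + l₁) := by
  have p12 := mink_neg_of_null h₁₁ h₁2 h₂₂ h₂2 h12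
  have p02 := mink_neg_of_null h₀₀ h₀2 h₂₂ h₂2 h02
  have p01 := mink_neg_of_null h₀₀ h₀2 h₁₁ h₁2 h01
  have hp₀ : 0 < l₀ := hl₀ ▸ Real.sqrt_pos.mpr (neg_pos.mpr p12)
  have hp₁ : 0 < l₁ := hl₁ ▸ Real.sqrt_pos.mpr (neg_pos.mpr p02)
  have hp₂ : 0 < l₂ := hl₂ ▸ Real.sqrt_pos.mpr (neg_pos.mpr p01)
  have s₀ : mink h₁ h₂ = -l₀ ^ 2 := by rw [hl₀, Real.sq_sqrt (neg_pos.mpr p12).le, neg_neg]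
  have s₁ : mink h₀ h₂ = -l₁ ^ 2 := by rw [hl₁, Real.sq_sqrt (neg_pos.mpr p02).le, neg_neg]
  have s₂ : mink h₀ h₁ = -l₂ ^ 2 := by rw [hl₂, Real.sq_sqrt (neg_pos.mpr p01).le, neg_neg]
  rw [← heron_pos_iff_triangle hp₀ hp₁ hp₂]
  exact exists_equidistant_iff_heron_pos h₀₀ h₁₁ h₂₂ (pow_pos hp₀ 2) (pow_pos hp₁ 2)
    (pow_pos hp₂ 2) s₀ s₁ s₂
end

section
/- Let h₀, h₁, h₂ ∈ ℝ³ be nonzero vectors in the open positive light cone which are pairwise not scalar multiples of one another. If x and x' are two points of the upper hyperboloid (⟨x,x⟩ = −1, x₂ > 0 and likewise for x') such that ⟨x,h₀⟩ = ⟨x,h₁⟩ = ⟨x,h₂⟩ and ⟨x',h₀⟩ = ⟨x',h₁⟩ = ⟨x',h₂⟩, then x = x'. That is, the point equidistant from three horocycles with distinct centers, when it exists, is unique. -/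
/-- Two orthogonal vectors of the positive light cone are proportional. -/
theorem exists_eq_smul_of_mink_eq_zero_s5 {u v : Fin 3 → ℝ} (hu : mink u u = 0) (hv : mink v v = 0)
    (hu2 : 0 < u 2) (huv : mink u v = 0) : ∃ c : ℝ, v = c • u := by
  unfold mink at hu hv huv
  have hsum : (u 2 * v 0 - v 2 * u 0) ^ 2 + (u 2 * v 1 - v 2 * u 1) ^ 2 = 0 := by
    linear_combination (u 2) ^ 2 * hv + (v 2) ^ 2 * hu - 2 * u 2 * v 2 * huv
  have hw0 : u 2 * v 0 - v 2 * u 0 = 0 := by nlinarith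
  have hw1 : u 2 * v 1 - v 2 * u 1 = 0 := by nlinarith
  refine ⟨v 2 / u 2, funext fun i => ?_⟩
  have hne : u 2 ≠ 0 := hu2.ne'
  fin_cases i <;> simp only [Pi.smul_apply, smul_eq_mul, Fin.zero_eta, Fin.mk_one,
    Fin.reduceFinMk] <;> field_simp <;> linarith

/-- The square of the determinant of three vectors is minus their Gram determinant. -/
theorem det_sq_eq_neg_gram (a b c : Fin 3 → ℝ) :
    (Matrix.of ![a, b, c]).det ^ 2 = -(Matrix.of
      ![![mink a a, mink a b, mink a c], ![mink a b, mink b b, mink b c],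
        ![mink a c, mink b c, mink c c]]).det := by
  simp only [Matrix.det_fin_three, Matrix.of_apply, Matrix.cons_val, mink]
  ring

/-- A vector orthogonal to three linearly independent vectors vanishes. -/
theorem eq_zero_of_mink_eq_zero {a b c y : Fin 3 → ℝ} (hdet : (Matrix.of ![a, b, c]).det ≠ 0)
    (ha : mink y a = 0) (hb : mink y b = 0) (hc : mink y c = 0) : y = 0 := by
  have hker : (Matrix.of ![a, b, c]).mulVec ![y 0, y 1, -y 2] = 0 := by
    unfold mink at ha hb hc
    ext i
    fin_cases i <;> simp [Matrix.mulVec, dotProduct, Fin.sum_univ_three] <;> linarith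
  have hzero := Matrix.eq_zero_of_mulVec_eq_zero hdet hker
  ext i
  fin_cases i
  · simpa using congrFun hzero 0
  · simpa using congrFun hzero 1
  · simpa using congrFun hzero 2

theorem mink_smul_sub_smul (s t : ℝ) (x y z : Fin 3 → ℝ) :
    mink (s • x - t • y) z = s * mink x z - t * mink y z := by
  simp only [mink, Pi.sub_apply, Pi.smul_apply, smul_eq_mul]
  ring

/-- A point of the upper hyperboloid equidistant from three horocycles with
distinct centers is unique when it exists. -/
theorem equidistant_point_unique
    (h₀ h₁ h₂ : Fin 3 → ℝ)
    (h₀0 : h₀ ≠ 0) (h₀₀ : mink h₀ h₀ = 0) (h₀2 : 0 < h₀ 2)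
    (h₁0 : h₁ ≠ 0) (h₁₁ : mink h₁ h₁ = 0) (h₁2 : 0 < h₁ 2)
    (h₂0 : h₂ ≠ 0) (h₂₂ : mink h₂ h₂ = 0) (h₂2 : 0 < h₂ 2)
    (h01 : ¬ ∃ c : ℝ, h₁ = c • h₀)
    (h02 : ¬ ∃ c : ℝ, h₂ = c • h₀)
    (h12 : ¬ ∃ c : ℝ, h₂ = c • h₁)
    (x x' : Fin 3 → ℝ)
    (hxx : mink x x = -1) (hx2 : 0 < x 2)
    (hx'x' : mink x' x' = -1) (hx'2 : 0 < x' 2)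
    (hx01 : mink x h₀ = mink x h₁) (hx12 : mink x h₁ = mink x h₂)
    (hx'01 : mink x' h₀ = mink x' h₁) (hx'12 : mink x' h₁ = mink x' h₂) :
    x = x' := by
  have hdet : (Matrix.of ![h₀, h₁, h₂]).det ≠ 0 := by
    intro hzero
    have hgram := det_sq_eq_neg_gram h₀ h₁ h₂
    simp only [hzero, h₀₀, h₁₁, h₂₂, Matrix.det_fin_three, Matrix.of_apply,
      Matrix.cons_val] at hgram
    have hprod : mink h₀ h₁ * mink h₀ h₂ * mink h₁ h₂ = 0 := by linarith
    rcases mul_eq_zero.mp hprod with h | h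
    · rcases mul_eq_zero.mp h with h | h
      · exact h01 (exists_eq_smul_of_mink_eq_zero_s5 h₀₀ h₁₁ h₀2 h)
      · exact h02 (exists_eq_smul_of_mink_eq_zero_s5 h₀₀ h₂₂ h₀2 h)
    · exact h12 (exists_eq_smul_of_mink_eq_zero_s5 h₁₁ h₂₂ h₁2 h)
  have hs : mink x h₀ ≠ 0 := by
    intro h
    have hx := eq_zero_of_mink_eq_zero hdet h (hx01 ▸ h) (hx12 ▸ hx01 ▸ h)
    simp [hx] at hx2
  have hy : mink x' h₀ • x - mink x h₀ • x' = 0 := by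
    apply eq_zero_of_mink_eq_zero hdet <;> rw [mink_smul_sub_smul]
    · ring
    · rw [← hx01, ← hx'01]; ring
    · rw [← hx12, ← hx'12, ← hx01, ← hx'01]; ring
  generalize mink x h₀ = s at hs hy
  generalize mink x' h₀ = t at hy
  have hcoord (i : Fin 3) : t * x i = s * x' i := by
    simpa [sub_eq_zero] using congrFun hy i
  have hsq : t ^ 2 = s ^ 2 := by
    unfold mink at hxx hx'x'
    linear_combination t ^ 2 * hxx - s ^ 2 * hx'x' - (t * x 0 + s * x' 0) * hcoord 0
      - (t * x 1 + s * x' 1) * hcoord 1 + (t * x 2 + s * x' 2) * hcoord 2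
  rcases sq_eq_sq_iff_eq_or_eq_neg.mp hsq with rfl | rfl
  · exact funext fun i => mul_left_cancel₀ hs (hcoord i)
  · have hsum : s * (x 2 + x' 2) = 0 := by linarith [hcoord 2]
    rcases mul_eq_zero.mp hsum with h | h
    · exact absurd h hs
    · linarith
end

section
/- Let h₀, h₁, h₂ ∈ ℝ³ be nonzero vectors in the open positive light cone which are pairwise not scalar multiples of one another, set λⱼ = √(−⟨h_k,h_ℓ⟩) for {j,k,ℓ} = {0,1,2}, and suppose x is a point of the upper hyperboloid (⟨x,x⟩ = −1, x₂ > 0) with ⟨x,h₀⟩ = ⟨x,h₁⟩ = ⟨x,h₂⟩. Then the exponential ρ = −⟨x,h₀⟩ of the common signed hyperbolic distance from x to the three horocycles satisfies ρ² = 2λ₀²λ₁²λ₂² / ((λ₀+λ₁+λ₂)(λ₀+λ₁−λ₂)(λ₀+λ₂−λ₁)(λ₁+λ₂−λ₀)). -/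
theorem mink_comm (u v : Fin 3 → ℝ) : mink u v = mink v u := by
  simp only [mink]; ring

/-- Two vectors of the open positive light cone that are not proportional have negative
Minkowski product. -/
theorem mink_neg_of_lightlike {u v : Fin 3 → ℝ} (huu : mink u u = 0) (hvv : mink v v = 0)
    (hu : 0 < u 2) (hv : 0 < v 2) (huv : ¬ ∃ c : ℝ, v = c • u) : mink u v < 0 := by
  by_contra! h
  apply huv
  have hsum : (u 2 * v 0 - v 2 * u 0) ^ 2 + (u 2 * v 1 - v 2 * u 1) ^ 2
      = -(2 * (u 2 * v 2) * mink u v) := by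
    simp only [mink] at *
    linear_combination (u 2) ^ 2 * hvv + (v 2) ^ 2 * huu
  have hprod : 0 ≤ 2 * (u 2 * v 2) * mink u v := by positivity
  have h0 : u 2 * v 0 - v 2 * u 0 = 0 := by
    apply pow_eq_zero_iff two_ne_zero |>.1
    nlinarith [sq_nonneg (u 2 * v 0 - v 2 * u 0), sq_nonneg (u 2 * v 1 - v 2 * u 1)]
  have h1 : u 2 * v 1 - v 2 * u 1 = 0 := by
    apply pow_eq_zero_iff two_ne_zero |>.1
    nlinarith [sq_nonneg (u 2 * v 0 - v 2 * u 0), sq_nonneg (u 2 * v 1 - v 2 * u 1)]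
  refine ⟨v 2 / u 2, funext fun i => ?_⟩
  fin_cases i <;> simp <;> field_simp <;> linarith

/-- The Minkowski Gram determinant of four vectors of `ℝ³` vanishes. -/
theorem det_gram_mink_eq_zero (w : Fin 4 → Fin 3 → ℝ) :
    (Matrix.of fun i j => mink (w i) (w j)).det = 0 := by
  have hfactor : (Matrix.of fun i j => mink (w i) (w j)) =
      Matrix.of w * (Matrix.of fun (k : Fin 3) j => ![1, 1, -1] k * w j k) := by
    ext i j
    simp [Matrix.mul_apply, Fin.sum_univ_three, mink]
    ring
  by_contra hdet
  have hrank := Matrix.rank_of_isUnit _ ((Matrix.isUnit_iff_isUnit_det _).2 (Ne.isUnit hdet))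
  rw [hfactor] at hrank
  have hle := (Matrix.rank_mul_le_left (Matrix.of w)
    (Matrix.of fun (k : Fin 3) j => ![1, 1, -1] k * w j k)).trans (Matrix.rank_le_width _)
  simp only [Fintype.card_fin] at hrank
  omega

/-- The Gram determinant relation for three lightlike vectors and a unit timelike vector having
the same product with each of them. -/
theorem gram_relation_of_equidistant {h₀ h₁ h₂ x : Fin 3 → ℝ}
    (h₀₀ : mink h₀ h₀ = 0) (h₁₁ : mink h₁ h₁ = 0) (h₂₂ : mink h₂ h₂ = 0)
    (hxx : mink x x = -1) (hx01 : mink x h₀ = mink x h₁) (hx12 : mink x h₁ = mink x h₂) :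
    mink x h₀ ^ 2 * (2 * (mink h₁ h₂ * mink h₀ h₂ + mink h₀ h₂ * mink h₀ h₁
        + mink h₀ h₁ * mink h₁ h₂) - mink h₁ h₂ ^ 2 - mink h₀ h₂ ^ 2 - mink h₀ h₁ ^ 2)
      = -(2 * mink h₁ h₂ * mink h₀ h₂ * mink h₀ h₁) := by
  have h := det_gram_mink_eq_zero ![x, h₀, h₁, h₂]
  simp [Matrix.det_succ_row_zero, Fin.sum_univ_succ, Fin.succAbove, mink_comm h₁ h₀,
    mink_comm h₂ h₀, mink_comm h₂ h₁, mink_comm _ x, h₀₀, h₁₁, h₂₂, hxx, ← hx12, ← hx01] at h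
  linear_combination -h

/-- The exponential `ρ = −⟨x,h₀⟩` of the common distance from the equidistant
point `x` to the three horocycles is given by the Heron-type formula in the
pairwise lambda lengths. -/
theorem equidistant_point_distance_formula
    (h₀ h₁ h₂ : Fin 3 → ℝ)
    (h₀0 : h₀ ≠ 0) (h₀₀ : mink h₀ h₀ = 0) (h₀2 : 0 < h₀ 2)
    (h₁0 : h₁ ≠ 0) (h₁₁ : mink h₁ h₁ = 0) (h₁2 : 0 < h₁ 2)
    (h₂0 : h₂ ≠ 0) (h₂₂ : mink h₂ h₂ = 0) (h₂2 : 0 < h₂ 2)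
    (h01 : ¬ ∃ c : ℝ, h₁ = c • h₀)
    (h02 : ¬ ∃ c : ℝ, h₂ = c • h₀)
    (h12 : ¬ ∃ c : ℝ, h₂ = c • h₁)
    (l₀ l₁ l₂ : ℝ)
    (hl₀ : l₀ = Real.sqrt (-(mink h₁ h₂)))
    (hl₁ : l₁ = Real.sqrt (-(mink h₀ h₂)))
    (hl₂ : l₂ = Real.sqrt (-(mink h₀ h₁)))
    (x : Fin 3 → ℝ)
    (hxx : mink x x = -1) (hx2 : 0 < x 2)
    (hx01 : mink x h₀ = mink x h₁) (hx12 : mink x h₁ = mink x h₂)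
    (ρ : ℝ) (hρ : ρ = -(mink x h₀)) :
    ρ ^ 2 = 2 * l₀ ^ 2 * l₁ ^ 2 * l₂ ^ 2 /
      ((l₀ + l₁ + l₂) * (l₀ + l₁ - l₂) * (l₀ + l₂ - l₁) * (l₁ + l₂ - l₀)) := by
  have ha := mink_neg_of_lightlike h₁₁ h₂₂ h₁2 h₂2 h12
  have hb := mink_neg_of_lightlike h₀₀ h₂₂ h₀2 h₂2 h02
  have hc := mink_neg_of_lightlike h₀₀ h₁₁ h₀2 h₁2 h01
  have hrel := gram_relation_of_equidistant h₀₀ h₁₁ h₂₂ hxx hx01 hx12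
  have hl₀_sq : l₀ ^ 2 = -(mink h₁ h₂) := by rw [hl₀, Real.sq_sqrt (by linarith)]
  have hl₁_sq : l₁ ^ 2 = -(mink h₀ h₂) := by rw [hl₁, Real.sq_sqrt (by linarith)]
  have hl₂_sq : l₂ ^ 2 = -(mink h₀ h₁) := by rw [hl₂, Real.sq_sqrt (by linarith)]
  have hl₀_pos : 0 < l₀ := hl₀ ▸ Real.sqrt_pos.2 (by linarith)
  have hl₁_pos : 0 < l₁ := hl₁ ▸ Real.sqrt_pos.2 (by linarith)
  have hl₂_pos : 0 < l₂ := hl₂ ▸ Real.sqrt_pos.2 (by linarith)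
  rw [show mink h₁ h₂ = -l₀ ^ 2 by linarith, show mink h₀ h₂ = -l₁ ^ 2 by linarith,
    show mink h₀ h₁ = -l₂ ^ 2 by linarith, show mink x h₀ = -ρ by linarith] at hrel
  have hheron : ρ ^ 2 * ((l₀ + l₁ + l₂) * (l₀ + l₁ - l₂) * (l₀ + l₂ - l₁) * (l₁ + l₂ - l₀))
      = 2 * l₀ ^ 2 * l₁ ^ 2 * l₂ ^ 2 := by
    linear_combination hrel
  have hpos : 0 < 2 * l₀ ^ 2 * l₁ ^ 2 * l₂ ^ 2 := by positivity
  refine eq_div_of_mul_eq (fun hzero => ?_) hheron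
  rw [hzero, mul_zero] at hheron
  linarith
end

section
/- Let a, b, c, d, e be positive real numbers with c + d ≤ e, and suppose the simplicial coordinate E = (a²+b²−e²)/(abe) + (c²+d²−e²)/(cde) is nonnegative. Then (a−b)² ≥ e²; in particular, the triangle inequality also fails for the triple a, b, e (either a ≥ b + e or b ≥ a + e). -/
/-- If `c + d ≤ e` and the simplicial coordinate
`E = (a²+b²−e²)/(abe) + (c²+d²−e²)/(cde)` is nonnegative, then `(a−b)² ≥ e²`;
in particular the triangle inequality fails for the triple `a, b, e`. -/
theorem simplicial_coordinate_triangle_failure_propagates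
    (a b c d e : ℝ) (ha : 0 < a) (hb : 0 < b) (hc : 0 < c) (hd : 0 < d)
    (he : 0 < e) (hcd : c + d ≤ e)
    (hE : 0 ≤ (a ^ 2 + b ^ 2 - e ^ 2) / (a * b * e)
            + (c ^ 2 + d ^ 2 - e ^ 2) / (c * d * e)) :
    e ^ 2 ≤ (a - b) ^ 2 ∧ (b + e ≤ a ∨ a + e ≤ b) := by
  have hcde : (c ^ 2 + d ^ 2 - e ^ 2) / (c * d * e) ≤ -2 / e := by
    rw [div_le_div_iff₀ (by positivity) he]
    have hsq : (c + d) ^ 2 ≤ e ^ 2 := by gcongr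
    nlinarith
  have habe : 2 / e ≤ (a ^ 2 + b ^ 2 - e ^ 2) / (a * b * e) := by
    rw [neg_div] at hcde
    linarith
  have hsq : e ^ 2 ≤ (a - b) ^ 2 := by
    rw [div_le_div_iff₀ he (by positivity)] at habe
    have hab : 2 * (a * b) ≤ a ^ 2 + b ^ 2 - e ^ 2 :=
      le_of_mul_le_mul_right (by linarith) he
    linarith
  refine ⟨hsq, ?_⟩
  have habs : e ≤ |a - b| := by
    simpa [abs_of_pos he] using sq_le_sq.mp hsq
  rcases le_abs.mp habs with h | h
  · left
    linarith
  · right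
    linarith
end

section
/- Let n ≥ 1 and let e, b : ℤ/nℤ → ℝ take only positive values. For j ∈ ℤ/nℤ define the simplicial coordinate of the consecutive edge e_j by E_j = (e_{j−1}² + b_j² − e_j²)/(e_{j−1} b_j e_j) + (e_{j+1}² + b_{j+1}² − e_j²)/(e_{j+1} b_{j+1} e_j), and define the included h-length of the cycle at t_j to be b_j/(e_{j−1} e_j). Then Σ_{j∈ℤ/nℤ} E_j = 2 Σ_{j∈ℤ/nℤ} b_j/(e_{j−1} e_j); that is, the sum of the simplicial coordinates of the consecutive edges of a cycle of triangles is twice the sum of the included h-lengths. -/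
/-- For a cycle of triangles, the sum of the simplicial coordinates of the
consecutive edges is twice the sum of the included h-lengths. -/
theorem cycle_simplicial_sum_eq_twice_h_length_sum
    (n : ℕ) [NeZero n] (e b : ZMod n → ℝ)
    (he : ∀ j, 0 < e j) (hb : ∀ j, 0 < b j) :
    ∑ j : ZMod n,
        ((e (j - 1) ^ 2 + b j ^ 2 - e j ^ 2) / (e (j - 1) * b j * e j)
          + (e (j + 1) ^ 2 + b (j + 1) ^ 2 - e j ^ 2) / (e (j + 1) * b (j + 1) * e j))
      = 2 * ∑ j : ZMod n, b j / (e (j - 1) * e j) := by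
  have shift : ∑ j, (e (j + 1) ^ 2 + b (j + 1) ^ 2 - e j ^ 2) / (e (j + 1) * b (j + 1) * e j)
      = ∑ j, (e j ^ 2 + b j ^ 2 - e (j - 1) ^ 2) / (e j * b j * e (j - 1)) :=
    Fintype.sum_equiv (Equiv.addRight 1) _ _ fun j => by simp
  rw [Finset.sum_add_distrib, shift, ← Finset.sum_add_distrib, Finset.mul_sum]
  refine Finset.sum_congr rfl fun j _ => ?_
  have hj := (he j).ne'
  have hpred := (he (j - 1)).ne'
  have hbj := (hb j).ne'
  field_simp
  ring
end
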